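/- arXiv:1405.1487 — 2 statements merged into one kernel-verified Lean document; each statement's English description precedes it below -/
import Mathlib

section
/- For every k ∈ ℝ, the characteristic polynomial of the twisted transition matrix P(k) satisfies det(λI₄ − P(k)) = (λ/9)(9λ³ − 7λ − 2cos k), i.e. det(λI₄ − P(k)) = λ⁴ − (7/9)λ² − (2/9)λ cos k. -/
noncomputable section
open Complex

/-- The twisted transition matrix `P(k)` of the random walk on the fundamental
domain of `C₄'`, with rows and columns indexed by the vertices `(0', u, d, 0)`. -/
def Pmat (k : ℝ) : Matrix (Fin 4) (Fin 4) ℂ :=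
  !![0, 1/2, 1/2, Complex.exp (Complex.I * k) / 3;
     1/3, 0, 0, 1/3;
     1/3, 0, 0, 1/3;
     Complex.exp (-(Complex.I * k)) / 3, 1/2, 1/2, 0]

/-- For every `k ∈ ℝ`, the characteristic polynomial of
`P(k)` satisfies `det(λI₄ − P(k)) = (λ/9)(9λ³ − 7λ − 2cos k)
= λ⁴ − (7/9)λ² − (2/9)λ cos k`. -/
theorem charpoly_twisted_random_walk (k : ℝ) (lam : ℂ) :
    Matrix.det (lam • (1 : Matrix (Fin 4) (Fin 4) ℂ) - Pmat k) =
      (lam / 9) * (9 * lam ^ 3 - 7 * lam - 2 * (Real.cos k : ℂ)) ∧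
    Matrix.det (lam • (1 : Matrix (Fin 4) (Fin 4) ℂ) - Pmat k) =
      lam ^ 4 - (7 / 9) * lam ^ 2 - (2 / 9) * lam * (Real.cos k : ℂ) := by
  have exp_mul_exp_neg : exp (I * k) * exp (-(I * k)) = 1 := by
    rw [← exp_add, add_neg_cancel, exp_zero]
  have two_mul_cos : 2 * (Real.cos k : ℂ) = exp (I * k) + exp (-(I * k)) := by
    rw [ofReal_cos, two_cos, neg_mul, mul_comm (k : ℂ) I]
  have det_eq : Matrix.det (lam • (1 : Matrix (Fin 4) (Fin 4) ℂ) - Pmat k) =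
      lam ^ 4 - (7 / 9) * lam ^ 2 - (2 / 9) * lam * (Real.cos k : ℂ) := by
    simp [Pmat, Matrix.det_succ_row_zero, Fin.sum_univ_succ, Fin.succAbove, -ofReal_cos,
      Matrix.one_apply]
    linear_combination (-lam ^ 2 / 9) * exp_mul_exp_neg + (lam / 9) * two_mul_cos
  exact ⟨by rw [det_eq]; ring, det_eq⟩
end
end

section
/- For every k ∈ ℝ: (1) each of λ₀(k), λ₁(k), λ₂(k) satisfies the cubic equation 9λ³ − 7λ − 2cos k = 0; (2) λ₀(k), λ₁(k), λ₂(k) are pairwise distinct; (3) every real root of 9λ³ − 7λ − 2cos k = 0 equals λ_j(k) for some j ∈ {0,1,2}. -/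
noncomputable section

/-- The constant `A = 9√3/(7√7)`. -/
def Aconst : ℝ := 9 * Real.sqrt 3 / (7 * Real.sqrt 7)

/-- `ξ_j(k) = (1/3)·arccos(A·cos k) + 2jπ/3`. -/
def xi (j : ℕ) (k : ℝ) : ℝ :=
  (1 / 3) * Real.arccos (Aconst * Real.cos k) + 2 * j * Real.pi / 3

/-- `λ_j(k) = (2√7/(3√3))·cos(ξ_j(k))`, the three roots of `9λ³ − 7λ − 2cos k = 0`. -/
def lam (j : ℕ) (k : ℝ) : ℝ :=
  (2 * Real.sqrt 7 / (3 * Real.sqrt 3)) * Real.cos (xi j k)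

/-- `x_{j,l}(k) = (−1)^l · λ_j'(k)/√(1 − λ_j(k)²)`. -/
def xfun (j l : ℕ) (k : ℝ) : ℝ :=
  (-1) ^ l * deriv (lam j) k / Real.sqrt (1 - lam j k ^ 2)

lemma sqrt_ratio_sq : (2 * Real.sqrt 7 / (3 * Real.sqrt 3)) ^ 2 = 28 / 27 := by
  rw [div_pow, mul_pow, mul_pow, Real.sq_sqrt (by norm_num), Real.sq_sqrt (by norm_num)]
  norm_num

lemma sqrt_ratio_mul_Aconst : 2 * Real.sqrt 7 / (3 * Real.sqrt 3) * Aconst = 6 / 7 := by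
  have h3 : Real.sqrt 3 ≠ 0 := by positivity
  have h7 : Real.sqrt 7 ≠ 0 := by positivity
  unfold Aconst
  field_simp
  norm_num

lemma Aconst_pos : 0 < Aconst := by
  unfold Aconst
  positivity

lemma Aconst_lt_one : Aconst < 1 := by
  have hsq : Aconst ^ 2 = 243 / 343 := by
    unfold Aconst
    rw [div_pow, mul_pow, mul_pow, Real.sq_sqrt (by norm_num), Real.sq_sqrt (by norm_num)]
    norm_num
  nlinarith [Aconst_pos]

lemma abs_Aconst_mul_cos_lt_one (k : ℝ) : |Aconst * Real.cos k| < 1 := by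
  rw [abs_mul, abs_of_pos Aconst_pos]
  calc Aconst * |Real.cos k| ≤ Aconst * 1 :=
        mul_le_mul_of_nonneg_left (Real.abs_cos_le_one k) Aconst_pos.le
    _ < 1 := by simpa using Aconst_lt_one

lemma cos_three_mul_xi (j : ℕ) (k : ℝ) : Real.cos (3 * xi j k) = Aconst * Real.cos k := by
  have h := abs_lt.mp (abs_Aconst_mul_cos_lt_one k)
  have hxi : 3 * xi j k = Real.arccos (Aconst * Real.cos k) + j * (2 * Real.pi) := by
    unfold xi
    ring
  rw [hxi, Real.cos_add_nat_mul_two_pi, Real.cos_arccos h.1.le h.2.le]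

lemma lam_cubic (j : ℕ) (k : ℝ) : 9 * lam j k ^ 3 - 7 * lam j k - 2 * Real.cos k = 0 := by
  have h := cos_three_mul_xi j k
  rw [Real.cos_three_mul] at h
  have hsq := sqrt_ratio_sq
  have hA := sqrt_ratio_mul_Aconst
  unfold lam
  set c := 2 * Real.sqrt 7 / (3 * Real.sqrt 3)
  set u := Real.cos (xi j k)
  linear_combination 9 * c * u ^ 3 * hsq + 7 / 3 * c * h + 7 / 3 * Real.cos k * hA

lemma lam_one_lt_lam_two_lt_lam_zero (k : ℝ) : lam 1 k < lam 2 k ∧ lam 2 k < lam 0 k := by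
  have h := abs_lt.mp (abs_Aconst_mul_cos_lt_one k)
  have hpos : 0 < Real.arccos (Aconst * Real.cos k) := Real.arccos_pos.mpr h.2
  have hlt : Real.arccos (Aconst * Real.cos k) < Real.pi := Real.arccos_lt_pi.mpr h.1
  have hc : 0 < 2 * Real.sqrt 7 / (3 * Real.sqrt 3) := by positivity
  have h2 : Real.cos (xi 2 k) = Real.cos (2 * Real.pi - xi 2 k) := (Real.cos_two_pi_sub _).symm
  unfold lam
  rw [h2]
  unfold xi
  push_cast
  constructor <;> refine mul_lt_mul_of_pos_left ?_ hc <;>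
    apply Real.cos_lt_cos_of_nonneg_of_le_pi <;> linarith

/-- A real depressed cubic `9x³ − 7x − d` with three distinct roots has no further root. -/
lemma eq_of_depressed_cubic {a b c d x : ℝ} (ha : 9 * a ^ 3 - 7 * a - d = 0)
    (hb : 9 * b ^ 3 - 7 * b - d = 0) (hc : 9 * c ^ 3 - 7 * c - d = 0)
    (hab : a ≠ b) (hac : a ≠ c) (hbc : b ≠ c) (hx : 9 * x ^ 3 - 7 * x - d = 0) :
    x = a ∨ x = b ∨ x = c := by
  have quot {y z : ℝ} (hy : 9 * y ^ 3 - 7 * y - d = 0) (hz : 9 * z ^ 3 - 7 * z - d = 0)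
      (hyz : y ≠ z) : 9 * (y ^ 2 + y * z + z ^ 2) - 7 = 0 :=
    mul_left_cancel₀ (sub_ne_zero.mpr hyz) (by linear_combination hy - hz)
  have sum {y z : ℝ} (hy : 9 * y ^ 3 - 7 * y - d = 0) (hz : 9 * z ^ 3 - 7 * z - d = 0)
      (hay : a ≠ y) (haz : a ≠ z) (hyz : y ≠ z) : a + y + z = 0 :=
    mul_left_cancel₀ (sub_ne_zero.mpr hyz)
      (by linear_combination (quot ha hy hay - quot ha hz haz) / 9)
  by_contra! hne
  exact hne.2.2 (by linarith [sum hb hc hab hac hbc, sum hb hx hab hne.1.symm hne.2.1.symm])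

/-- For every `k ∈ ℝ`: (1) each `λ_j(k)`, `j ∈ {0,1,2}`,
satisfies `9λ³ − 7λ − 2cos k = 0`; (2) `λ₀(k), λ₁(k), λ₂(k)` are pairwise
distinct; (3) every real root of the cubic is one of the `λ_j(k)`. -/
theorem lam_roots_of_cubic (k : ℝ) :
    (∀ j < 3, 9 * lam j k ^ 3 - 7 * lam j k - 2 * Real.cos k = 0) ∧
    (lam 0 k ≠ lam 1 k ∧ lam 0 k ≠ lam 2 k ∧ lam 1 k ≠ lam 2 k) ∧
    (∀ x : ℝ, 9 * x ^ 3 - 7 * x - 2 * Real.cos k = 0 → ∃ j < 3, x = lam j k) := by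
  obtain ⟨h12, h20⟩ := lam_one_lt_lam_two_lt_lam_zero k
  have h10 := h12.trans h20
  refine ⟨fun j _ => lam_cubic j k, ⟨h10.ne', h20.ne', h12.ne⟩, fun x hx => ?_⟩
  rcases eq_of_depressed_cubic (lam_cubic 0 k) (lam_cubic 1 k) (lam_cubic 2 k)
    h10.ne' h20.ne' h12.ne hx with h | h | h
  · exact ⟨0, by norm_num, h⟩
  · exact ⟨1, by norm_num, h⟩
  · exact ⟨2, by norm_num, h⟩
end
end
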